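/- Let n, m ≥ 0 be integers with 2n+m ≥ 2, and let G be a finite simple graph with arboricity arb(G) = r and (n,m)-chromatic number χ_{n,m}(G) = k. Then the acyclic chromatic number of G satisfies χ_a(G) ≤ k^{⌈log_{2n+m} r⌉ + 1}. -/

import Mathlib

open SimpleGraph

/-- The involution pairing the label of an arc with the label of the corresponding
reverse arc: for `1 ≤ k ≤ 2n`, the labels `2i` (arc of type `i`) and `2i-1`
(reverse arc of type `i`) are swapped; edge labels `2n+1, …, 2n+m` are fixed. -/
def conjLab (n k : ℕ) : ℕ :=
  if k ≤ 2 * n then (if k % 2 = 0 then k - 1 else k + 1) else k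

/-- An `(n,m)`-graph: a simple underlying graph together with a labelling of each
ordered pair of adjacent vertices by a number in `{1, …, 2n+m}` (`lab u v = α`
means that `v` is an `α`-neighbor of `u`), compatible with reversal. -/
structure NMGraph (n m : ℕ) (V : Type) where
  und : SimpleGraph V
  lab : V → V → ℕ
  lab_mem : ∀ u v, und.Adj u v → 1 ≤ lab u v ∧ lab u v ≤ 2 * n + m
  lab_conj : ∀ u v, und.Adj u v → lab v u = conjLab n (lab u v)

/-- `N^α(u)`, the set of `α`-neighbors of `u`. -/
def NMGraph.nbr {n m : ℕ} {V : Type} (G : NMGraph n m V) (α : ℕ) (u : V) : Set V :=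
  {v | G.und.Adj u v ∧ G.lab u v = α}

/-- `G → H`: existence of a homomorphism of `(n,m)`-graphs, i.e. a vertex map
preserving adjacency together with the type (and direction) of every arc/edge. -/
def NMGraph.HomTo {n m : ℕ} {V W : Type} (G : NMGraph n m V) (H : NMGraph n m W) : Prop :=
  ∃ f : V → W, ∀ u v, G.und.Adj u v →
    H.und.Adj (f u) (f v) ∧ H.lab (f u) (f v) = G.lab u v

/-- The `(n,m)`-chromatic number of an `(n,m)`-graph: the least number of vertices
of a target of a homomorphism. -/
noncomputable def nmChrom (n m : ℕ) {V : Type} (G : NMGraph n m V) : ℕ :=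
  sInf {t | ∃ H : NMGraph n m (Fin t), G.HomTo H}

/-- The arboricity of a simple graph: the least `r` such that the edge set can be
partitioned into `r` forests. -/
noncomputable def arboricity {V : Type} (G : SimpleGraph V) : ℕ :=
  sInf {r | ∃ F : Fin r → SimpleGraph V,
    (∀ i, (F i).IsAcyclic) ∧
    (∀ u v, G.Adj u v ↔ ∃ i, (F i).Adj u v) ∧
    (∀ i j u v, (F i).Adj u v → (F j).Adj u v → i = j)}

/-- The acyclic chromatic number: the least `s` admitting a proper `s`-coloring in
which the union of any two color classes induces a forest. -/
noncomputable def acyclicChromatic {V : Type} (G : SimpleGraph V) : ℕ :=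
  sInf {s | ∃ c : V → Fin s, (∀ u v, G.Adj u v → c u ≠ c v) ∧
    ∀ i j : Fin s, (SimpleGraph.induce {v : V | c v = i ∨ c v = j} G).IsAcyclic}

/-- The `(n,m)`-chromatic number of a simple graph: the maximum of `nmChrom` over
all `(n,m)`-graphs with that underlying graph. -/
noncomputable def nmChromGraph (n m : ℕ) {V : Type} (S : SimpleGraph V) : ℕ :=
  sSup {k | ∃ G : NMGraph n m V, G.und = S ∧ nmChrom n m G = k}

lemma conjLab_conjLab {n k : ℕ} (hk : 1 ≤ k) : conjLab n (conjLab n k) = k := by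
  unfold conjLab
  split_ifs <;> omega

lemma one_le_conjLab {n k : ℕ} (hk : 1 ≤ k) : 1 ≤ conjLab n k := by
  unfold conjLab
  split_ifs <;> omega

lemma conjLab_le {n m k : ℕ} (hk : k ≤ 2 * n + m) : conjLab n k ≤ 2 * n + m := by
  unfold conjLab
  split_ifs <;> omega

/-- A vertex numbering and a symmetric assignment of labels to the edges determine an
`(n,m)`-graph: the label of an edge is read from its smaller to its larger endpoint. -/
def NMGraph.ofNumbering {n m N : ℕ} {V : Type} (S : SimpleGraph V) (e : V ≃ Fin N)
    (d : V → V → Fin (2 * n + m)) (hd : ∀ u v, S.Adj u v → d v u = d u v) :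
    NMGraph n m V where
  und := S
  lab u v := if e u < e v then (d u v : ℕ) + 1 else conjLab n (d u v + 1)
  lab_mem u v _ := by
    have h1 : 1 ≤ (d u v : ℕ) + 1 := by omega
    have h2 : (d u v : ℕ) + 1 ≤ 2 * n + m := (d u v).isLt
    split_ifs
    · exact ⟨h1, h2⟩
    · exact ⟨one_le_conjLab h1, conjLab_le h2⟩
  lab_conj u v huv := by
    have hne : e u ≠ e v := fun h => huv.ne (e.injective h)
    rw [hd u v huv]
    rcases lt_or_gt_of_ne hne with h | h
    · rw [if_neg h.not_gt, if_pos h]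
    · rw [if_pos h, if_neg h.not_gt, conjLab_conjLab (by omega)]

lemma nmChrom_spec {n m : ℕ} {V : Type} [Fintype V] (G : NMGraph n m V) :
    nmChrom n m G ≤ Fintype.card V ∧ ∃ H : NMGraph n m (Fin (nmChrom n m G)), G.HomTo H := by
  have hmem : Fintype.card V ∈ {t | ∃ H : NMGraph n m (Fin t), G.HomTo H} := by
    let e := (Fintype.equivFin V).symm
    refine ⟨⟨G.und.comap e, fun u v => G.lab (e u) (e v), fun u v h => G.lab_mem _ _ h,
      fun u v h => G.lab_conj _ _ h⟩, e.symm, fun u v h => ?_⟩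
    simpa using h
  exact ⟨Nat.sInf_le hmem, Nat.sInf_mem ⟨_, hmem⟩⟩

lemma nmChrom_le_nmChromGraph {n m : ℕ} {V : Type} [Fintype V] (G : NMGraph n m V) :
    nmChrom n m G ≤ nmChromGraph n m G.und := by
  refine le_csSup ⟨Fintype.card V, ?_⟩ ⟨G, rfl, rfl⟩
  rintro _ ⟨G', -, rfl⟩
  exact (nmChrom_spec G').1

/-- Every `(n,m)`-graph has a proper coloring by `nmChromGraph` colors in which the colors of
the endpoints determine the label. -/
lemma NMGraph.exists_coloring {n m : ℕ} {V : Type} [Fintype V] (G : NMGraph n m V) :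
    ∃ f : V → Fin (nmChromGraph n m G.und),
      (∀ u v, G.und.Adj u v → f u ≠ f v) ∧
      ∀ u v u' v', G.und.Adj u v → G.und.Adj u' v' → f u = f u' → f v = f v' →
        G.lab u v = G.lab u' v' := by
  obtain ⟨-, H, f, hf⟩ := nmChrom_spec G
  have hinj := Fin.castLE_injective (nmChrom_le_nmChromGraph G)
  refine ⟨fun v => Fin.castLE (nmChrom_le_nmChromGraph G) (f v), fun u v h he => ?_,
    fun u v u' v' h h' hu hv => ?_⟩
  · exact (hf u v h).1.ne (hinj he)
  · rw [← (hf u v h).2, ← (hf u' v' h').2, hinj hu, hinj hv]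

lemma isAcyclic_of_edgeSet_subsingleton {V : Type} {G : SimpleGraph V}
    (hG : G.edgeSet.Subsingleton) : G.IsAcyclic := by
  intro v c hc
  have hnodup := hc.edges_nodup
  have hlen := hc.three_le_length
  rw [← c.length_edges] at hlen
  have hmem : ∀ a ∈ c.edges, a ∈ G.edgeSet := fun a ha => c.edges_subset_edgeSet ha
  have h01 : c.edges[0] = c.edges[1] :=
    hG (hmem _ (List.getElem_mem _)) (hmem _ (List.getElem_mem _))
  simpa using (hnodup.getElem_inj_iff).1 h01

lemma arboricity_spec {V : Type} [Fintype V] (S : SimpleGraph V) :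
    ∃ F : Fin (arboricity S) → SimpleGraph V,
      (∀ i, (F i).IsAcyclic) ∧
      (∀ u v, S.Adj u v ↔ ∃ i, (F i).Adj u v) ∧
      (∀ i j u v, (F i).Adj u v → (F j).Adj u v → i = j) := by
  classical
  refine Nat.sInf_mem (s := {r | ∃ F : Fin r → SimpleGraph V,
    (∀ i, (F i).IsAcyclic) ∧
    (∀ u v, S.Adj u v ↔ ∃ i, (F i).Adj u v) ∧
    (∀ i j u v, (F i).Adj u v → (F j).Adj u v → i = j)}) ?_
  let e := (Fintype.equivFin S.edgeSet).symm
  refine ⟨Fintype.card S.edgeSet, fun i => fromEdgeSet {(e i : Sym2 V)}, fun i => ?_,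
    fun u v => ⟨fun h => ?_, ?_⟩, fun i j u v hi hj => ?_⟩
  · apply isAcyclic_of_edgeSet_subsingleton
    rw [edgeSet_fromEdgeSet]
    exact Set.subsingleton_singleton.anti Set.sdiff_subset
  · refine ⟨e.symm ⟨s(u, v), h⟩, ?_⟩
    simp [fromEdgeSet_adj, h.ne]
  · rintro ⟨i, hi⟩
    rw [fromEdgeSet_adj, Set.mem_singleton_iff] at hi
    rw [← mem_edgeSet, hi.1]
    exact (e i).2
  · rw [fromEdgeSet_adj, Set.mem_singleton_iff] at hi hj
    exact e.injective (Subtype.ext (hi.1.symm.trans hj.1))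

/-- For a symmetric family of edge labellings by `2n+m` symbols, there is a proper coloring by
one more than as many coordinates in which the colors of the endpoints determine all labels. -/
lemma exists_coloring_determining {n m l : ℕ} (hp : 2 ≤ 2 * n + m) {V : Type} [Fintype V]
    (S : SimpleGraph V) (t : V → V → Fin l → Fin (2 * n + m))
    (ht : ∀ u v, S.Adj u v → t v u = t u v) :
    ∃ c : V → Fin (l + 1) → Fin (nmChromGraph n m S),
      (∀ u v, S.Adj u v → c u ≠ c v) ∧
      ∀ u v u' v', S.Adj u v → S.Adj u' v' → c u = c u' → c v = c v' → t u v = t u' v' := by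
  let e := Fintype.equivFin V
  obtain ⟨f₀, hproper, hf₀⟩ := (NMGraph.ofNumbering (n := n) (m := m) S e
    (fun _ _ => ⟨0, by omega⟩) (fun _ _ _ => rfl)).exists_coloring
  choose f _ hf using fun i => (NMGraph.ofNumbering S e (fun u v => t u v i)
    (fun u v h => congrFun (ht u v h) i)).exists_coloring
  refine ⟨fun v => Fin.cons (f₀ v) fun i => f i v, fun u v h he => ?_,
    fun u v u' v' h h' hu hv => funext fun i => ?_⟩
  · exact hproper u v h (congrFun he 0)
  · have h0 := hf₀ u v u' v' h h' (congrFun hu 0) (congrFun hv 0)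
    have hi := hf i u v u' v' h h' (congrFun hu i.succ)
      (congrFun hv i.succ)
    simp only [NMGraph.ofNumbering] at h0 hi
    apply Fin.ext
    generalize (t u v i : ℕ) = a at *
    generalize (t u' v' i : ℕ) = b at *
    unfold conjLab at h0 hi
    split_ifs at h0 hi <;> omega

lemma isAcyclic_induce_of_coloring {V C : Type} {S : SimpleGraph V} {r : ℕ}
    {F : Fin r → SimpleGraph V} (hF : ∀ i, (F i).IsAcyclic)
    (hS : ∀ u v, S.Adj u v → ∃ i, (F i).Adj u v) {c : V → C}
    (hproper : ∀ u v, S.Adj u v → c u ≠ c v)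
    (hc : ∀ a b u v u' v', (F a).Adj u v → (F b).Adj u' v' → c u = c u' → c v = c v' → a = b)
    (i j : C) : (S.induce {v | c v = i ∨ c v = j}).IsAcyclic := by
  by_cases hE : ∃ u v, S.Adj u v ∧ c u = i ∧ c v = j
  · obtain ⟨u₀, v₀, h₀, rfl, rfl⟩ := hE
    obtain ⟨a, ha⟩ := hS _ _ h₀
    have key : ∀ u v : {v | c v = c u₀ ∨ c v = c v₀}, S.Adj u v → (F a).Adj u v := by
      rintro ⟨u, hu⟩ ⟨v, hv⟩ huv
      obtain ⟨b, hb⟩ := hS _ _ huv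
      have hne := hproper _ _ huv
      rcases hu with hu | hu <;> rcases hv with hv | hv
      · exact absurd (hu.trans hv.symm) hne
      · rwa [hc a b _ _ _ _ ha hb hu.symm hv.symm]
      · rwa [hc a b _ _ _ _ ha hb.symm hv.symm hu.symm]
      · exact absurd (hu.trans hv.symm) hne
    exact (hF a).comap ⟨Subtype.val, fun {u v} h => key u v h⟩ Subtype.val_injective
  · apply isAcyclic_of_edgeSet_subsingleton
    have hbot : S.induce {v | c v = i ∨ c v = j} = ⊥ := by
      rw [eq_bot_iff]
      rintro ⟨u, hu⟩ ⟨v, hv⟩ huv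
      have huv : S.Adj u v := huv
      have hne := hproper _ _ huv
      rcases hu with hu | hu <;> rcases hv with hv | hv
      · exact hne (hu.trans hv.symm)
      · exact hE ⟨u, v, huv, hu, hv⟩
      · exact hE ⟨v, u, huv.symm, hv, hu⟩
      · exact hne (hu.trans hv.symm)
    rw [hbot, SimpleGraph.edgeSet_bot]
    exact Set.subsingleton_empty

lemma acyclicChromatic_le_card {V C : Type} [Fintype C] {S : SimpleGraph V} {c : V → C}
    (hproper : ∀ u v, S.Adj u v → c u ≠ c v)
    (hc : ∀ i j, (S.induce {v | c v = i ∨ c v = j}).IsAcyclic) :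
    acyclicChromatic S ≤ Fintype.card C := by
  let e := Fintype.equivFin C
  refine Nat.sInf_le ⟨fun v => e (c v), fun u v h he => hproper u v h (e.injective he),
    fun i j => ?_⟩
  have hset : {v | e (c v) = i ∨ e (c v) = j} = {v | c v = e.symm i ∨ c v = e.symm j} := by
    simp only [Equiv.eq_symm_apply]
  rw [hset]
  exact hc (e.symm i) (e.symm j)

lemma acyclicChromatic_le_pow {n m l : ℕ} (hp : 2 ≤ 2 * n + m) {V : Type} [Fintype V]
    (S : SimpleGraph V) (hl : arboricity S ≤ (2 * n + m) ^ l) :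
    acyclicChromatic S ≤ nmChromGraph n m S ^ (l + 1) := by
  classical
  obtain ⟨F, hF, hS, huniq⟩ := arboricity_spec S
  let digits : Fin (arboricity S) → Fin l → Fin (2 * n + m) := fun a =>
    finFunctionFinEquiv.symm (Fin.castLE hl a)
  have hdigits : Function.Injective digits :=
    finFunctionFinEquiv.symm.injective.comp (Fin.castLE_injective hl)
  let t : V → V → Fin l → Fin (2 * n + m) := fun u v =>
    if h : ∃ a, (F a).Adj u v then digits h.choose else fun _ => ⟨0, by omega⟩
  have ht : ∀ a u v, (F a).Adj u v → t u v = digits a := fun a u v h => by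
    have hex : ∃ a, (F a).Adj u v := ⟨a, h⟩
    simp only [t, dif_pos hex]
    rw [huniq _ _ _ _ hex.choose_spec h]
  obtain ⟨c, hproper, hc⟩ := exists_coloring_determining hp S t fun u v h => by
    obtain ⟨a, ha⟩ := (hS u v).1 h
    rw [ht a u v ha, ht a v u ha.symm]
  have hle := acyclicChromatic_le_card hproper <|
    isAcyclic_induce_of_coloring hF (fun u v => (hS u v).1) hproper
      fun a b u v u' v' ha hb hu hv => hdigits <| by
        rw [← ht a u v ha, ← ht b u' v' hb]
        exact hc u v u' v' ((hS _ _).2 ⟨a, ha⟩) ((hS _ _).2 ⟨b, hb⟩) hu hv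
  simpa using hle

/-- If `arb(G) = r` and `χ_{n,m}(G) = k`, then `χ_a(G) ≤ k ^ (⌈log_{2n+m} r⌉ + 1)`. -/
theorem acyclicChromatic_le_of_arboricity_nmChrom (n m : ℕ) (hp : 2 ≤ 2 * n + m)
    {V : Type} [Fintype V] (S : SimpleGraph V) (r k : ℕ)
    (hr : arboricity S = r) (hk : nmChromGraph n m S = k) :
    (acyclicChromatic S : ℝ) ≤ (k : ℝ) ^ (⌈Real.logb (2 * n + m) r⌉ + 1) := by
  subst hr hk
  have hceil : ⌈Real.logb (2 * n + m) (arboricity S)⌉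
      = (Nat.clog (2 * n + m) (arboricity S) : ℤ) := by
    have h := Real.ceil_logb_natCast (b := 2 * n + m) (r := (arboricity S : ℝ)) (by positivity)
    rw [Int.clog_natCast] at h
    exact_mod_cast h
  rw [hceil]
  exact_mod_cast acyclicChromatic_le_pow hp S (Nat.le_pow_clog (by omega) _)
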